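/- Assume f is Gâteaux differentiable on A with f' continuous on A, and define c₁(t) := inf{⟨f'(x), x − x̄⟩ : x ∈ D_x̄, T_M(x, x̄) = t} for t ≥ 0 (with inf ∅ = +∞), and Q(x̄, ε) := {x ∈ D_x̄ : ⟨f'(x), x − x̄⟩ ≤ ε}. If diam(Q(x̄, ε)) → 0 as ε → 0, then c₁ is an admissible function. -/

import Mathlib

open Filter Topology Set
open scoped ENNReal

variable {X : Type*} [NormedAddCommGroup X] [NormedSpace ℝ X]

/-- The directional minimal time function `T_M(y,x) = inf {t ≥ 0 | ∃ m ∈ M, x = y + t•m}`,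
with values in `[0,∞]` and `inf ∅ = ∞`. -/
noncomputable def minTime (M : Set X) (y x : X) : ℝ≥0∞ :=
  sInf {t : ℝ≥0∞ | ∃ r : ℝ, 0 ≤ r ∧ t = ENNReal.ofReal r ∧ ∃ m ∈ M, x = y + r • m}

/-- The cone generated by `M`: `cone(M) = {t•m | t ≥ 0, m ∈ M}`. -/
def coneOf (M : Set X) : Set X := {p : X | ∃ t : ℝ, 0 ≤ t ∧ ∃ m ∈ M, p = t • m}

/-- `D_x := A ∩ dom T_M(·,x)`. -/
def Dset (M A : Set X) (x : X) : Set X := A ∩ {y : X | minTime M y x ≠ ⊤}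

/-- A function is admissible: value `0` at `0`, and every sequence `(t_k) ⊆ [0,∞)` whose
values tend to `0` satisfies `t_k → 0`. -/
def AdmissibleE (c : ℝ → EReal) : Prop :=
  c 0 = 0 ∧ ∀ t : ℕ → ℝ, (∀ k, 0 ≤ t k) →
    Tendsto (fun k => c (t k)) atTop (𝓝 0) → Tendsto t atTop (𝓝 0)

theorem minTime_eq_of_ne_top {M : Set X} (hM : M ⊆ Metric.sphere (0 : X) 1) {y x : X}
    (h : minTime M y x ≠ ⊤) : minTime M y x = ENNReal.ofReal ‖y - x‖ := by
  have key : ∀ t ∈ {t : ℝ≥0∞ | ∃ r : ℝ, 0 ≤ r ∧ t = ENNReal.ofReal r ∧ ∃ m ∈ M, x = y + r • m},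
      t = ENNReal.ofReal ‖y - x‖ := by
    rintro t ⟨r, hr, rfl, m, hm, rfl⟩
    have h1 : ‖m‖ = 1 := by simpa using hM hm
    simp [norm_smul, h1, abs_of_nonneg hr]
  unfold minTime at h ⊢
  rcases Set.eq_empty_or_nonempty
    {t : ℝ≥0∞ | ∃ r : ℝ, 0 ≤ r ∧ t = ENNReal.ofReal r ∧ ∃ m ∈ M, x = y + r • m} with he | ⟨t, ht⟩
  · rw [he] at h
    simp at h
  · apply le_antisymm
    · rw [← key t ht]
      exact sInf_le ht
    · exact le_sInf fun b hb => (key b hb).ge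

theorem minTime_self {M : Set X} (hM : M.Nonempty) (x : X) : minTime M x x = 0 := by
  obtain ⟨m, hm⟩ := hM
  apply le_antisymm _ bot_le
  exact sInf_le ⟨0, le_rfl, by simp, m, hm, by simp⟩

/-- Proposition 4.2: if `diam Q(x̄,ε) → 0` as `ε → 0⁺`, then
`c₁(t) = inf {⟨f'(x), x − x̄⟩ | x ∈ D_x̄, T_M(x,x̄) = t}` is an admissible function. -/
theorem cOne_admissible [CompleteSpace X]
    (M : Set X) (hMne : M.Nonempty) (hMcl : IsClosed M)
    (hMsph : M ⊆ Metric.sphere (0 : X) 1) (hMcone : Convex ℝ (coneOf M))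
    (A : Set X) (hAne : A.Nonempty) (hAcl : IsClosed A) (hAconv : Convex ℝ A)
    (f : X → ℝ) (hlsc : LowerSemicontinuousOn f A)
    (f' : X → (X →L[ℝ] ℝ))
    (hgat : ∀ x ∈ A, ∀ d : X,
      Tendsto (fun l : ℝ => (f (x + l • d) - f x) / l) (𝓝[≠] 0) (𝓝 (f' x d)))
    (hf'cont : ContinuousOn f' A)
    (xb : X) (hxb : xb ∈ A)
    (hmin : ∀ x ∈ Dset M A xb, f xb ≤ f x)
    (hsub : ∀ x ∈ Dset M A xb, ∀ s : ℝ, 0 ≤ s → s ≤ 1 →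
      f (s • x + (1 - s) • xb) ≤ s * f x + (1 - s) * f xb)
    (hQ : Tendsto (fun ε : ℝ =>
        EMetric.diam {x ∈ Dset M A xb | f' x (x - xb) ≤ ε}) (𝓝[>] 0) (𝓝 0)) :
    AdmissibleE (fun t : ℝ =>
      sInf {v : EReal | ∃ x ∈ Dset M A xb,
        minTime M x xb = ENNReal.ofReal t ∧ v = ((f' x (x - xb) : ℝ) : EReal)}) := by
  have hself := minTime_self hMne xb
  have hD : xb ∈ Dset M A xb := ⟨hxb, by simp [hself]⟩
  constructor
  · apply le_antisymm
    · exact sInf_le ⟨xb, hD, by simp [hself], by simp⟩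
    · apply le_sInf
      rintro v ⟨x, hx, hT, rfl⟩
      rw [minTime_eq_of_ne_top hMsph hx.2] at hT
      simp only [ENNReal.ofReal_zero, ENNReal.ofReal_eq_zero, norm_le_zero_iff] at hT
      simp [hT]
  · intro t ht hc
    rw [Metric.tendsto_atTop']
    intro δ hδ
    have h1 := hQ.eventually (gt_mem_nhds (ENNReal.ofReal_pos.2 hδ))
    obtain ⟨ε, hε, hε0⟩ := (h1.and self_mem_nhdsWithin).exists
    have hε0 : (0 : ℝ) < ε := hε0
    have h2 := hc.eventually (gt_mem_nhds (EReal.coe_pos.2 hε0))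
    obtain ⟨N, hN⟩ := eventually_atTop.1 h2
    refine ⟨N, fun n hn => ?_⟩
    obtain ⟨v, ⟨x, hx, hT, rfl⟩, hv⟩ := sInf_lt_iff.1 (hN n hn.le)
    have hv' : f' x (x - xb) < ε := EReal.coe_lt_coe_iff.1 hv
    have h3 : edist x xb ≤ EMetric.diam {x ∈ Dset M A xb | f' x (x - xb) ≤ ε} :=
      Metric.edist_le_ediam_of_mem ⟨hx, hv'.le⟩ ⟨hD, by simpa using hε0.le⟩
    have h4 := h3.trans_lt hε
    rw [edist_dist, dist_eq_norm, ← minTime_eq_of_ne_top hMsph hx.2, hT,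
      ENNReal.ofReal_lt_ofReal_iff hδ] at h4
    simpa [abs_of_nonneg (ht n)] using h4
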